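/- arXiv:1009.2830 — 4 statements merged into one kernel-verified Lean document; each statement's English description precedes it below -/
import Mathlib

section
/- Error bound for the lossless approximation of a memoryless system (Theorem 1): let τ > 0, ω₀ = π/τ, let k = k_s + k_a ∈ ℝ^{p×p} with k_s symmetric positive semidefinite and k_a antisymmetric, let u ∈ C²([0,τ], ℝᵖ) with u(0) = 0, and let N ≥ 2 be an integer. Define y(t) = k u(t) and y_N(t) = k_a u(t) + ∫₀ᵗ 2κ_N^c(t−s) u(s) ds, where κ_N^c(r) = k_s/(2τ) + Σ_{l=1}^{N−1} (k_s/τ) cos(l ω₀ r) for r ≥ 0. Then for every t ∈ [0,τ]: ‖y(t) − y_N(t)‖₂ ≤ (2 σ̄(k_s) τ / (π² (N−1))) · ( ‖u̇(t)‖₂ + ‖u̇(0)‖₂ + ∫₀ᵗ ‖ü(s)‖₁ ds ). -/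
open Matrix MeasureTheory

/-- Euclidean (`ℓ²`) norm of a vector in `ℝᵖ`. -/
noncomputable def vnorm2 {p : ℕ} (v : Fin p → ℝ) : ℝ :=
  Real.sqrt (∑ i, v i ^ 2)

/-- Entrywise `ℓ¹` norm of a vector in `ℝᵖ`. -/
noncomputable def vnorm1 {p : ℕ} (v : Fin p → ℝ) : ℝ :=
  ∑ i, |v i|

/-- Largest singular value of a real square matrix, i.e. its operator norm
as a map between Euclidean spaces. -/
noncomputable def sigmaMax {p : ℕ} (M : Matrix (Fin p) (Fin p) ℝ) : ℝ :=
  ‖Matrix.toEuclideanCLM (𝕜 := ℝ) M‖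

/-- The remainder after `m` terms of the cosine series `∑ cos (l θ) / l ^ 2`, whose sum on
`[0, 2π]` is `π ^ 2 / 6 - π θ / 2 + θ ^ 2 / 4`. -/
noncomputable def cosSeriesRemainder (m : ℕ) (θ : ℝ) : ℝ :=
  Real.pi ^ 2 / 6 - Real.pi * θ / 2 + θ ^ 2 / 4
    - ∑ l ∈ Finset.Icc 1 m, Real.cos (l * θ) / (l : ℝ) ^ 2

/-- The derivative of `cosSeriesRemainder`. -/
noncomputable def cosSeriesRemainderDeriv (m : ℕ) (θ : ℝ) : ℝ :=
  -Real.pi / 2 + θ / 2 + ∑ l ∈ Finset.Icc 1 m, Real.sin (l * θ) / (l : ℝ)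

theorem hasDerivAt_cosSeriesRemainder (m : ℕ) (θ : ℝ) :
    HasDerivAt (cosSeriesRemainder m) (cosSeriesRemainderDeriv m θ) θ := by
  have hsum : HasDerivAt (fun θ : ℝ => ∑ l ∈ Finset.Icc 1 m, Real.cos (l * θ) / (l : ℝ) ^ 2)
      (∑ l ∈ Finset.Icc 1 m, -(Real.sin (l * θ) / (l : ℝ))) θ := by
    refine HasDerivAt.fun_sum fun l hl => ?_
    have hl0 : (l : ℝ) ≠ 0 := by
      have := (Finset.mem_Icc.1 hl).1
      exact_mod_cast (by omega : l ≠ 0)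
    convert! (((hasDerivAt_id θ).const_mul (l : ℝ)).cos).div_const ((l : ℝ) ^ 2) using 1
    simp only [id]
    field_simp
  have hpoly : HasDerivAt (fun θ : ℝ => Real.pi ^ 2 / 6 - Real.pi * θ / 2 + θ ^ 2 / 4)
      (-Real.pi / 2 + θ / 2) θ := by
    convert! ((((hasDerivAt_id θ).const_mul Real.pi).div_const 2).const_sub (Real.pi ^ 2 / 6)).add
      (((hasDerivAt_id θ).pow 2).div_const 4) using 1
    simp only [id]
    ring
  convert! hpoly.sub hsum using 1
  rw [cosSeriesRemainderDeriv, Finset.sum_neg_distrib, sub_neg_eq_add]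

theorem hasDerivAt_cosSeriesRemainderDeriv (m : ℕ) (θ : ℝ) :
    HasDerivAt (cosSeriesRemainderDeriv m)
      (1 / 2 + ∑ l ∈ Finset.Icc 1 m, Real.cos (l * θ)) θ := by
  have hsum : HasDerivAt (fun θ : ℝ => ∑ l ∈ Finset.Icc 1 m, Real.sin (l * θ) / (l : ℝ))
      (∑ l ∈ Finset.Icc 1 m, Real.cos (l * θ)) θ := by
    refine HasDerivAt.fun_sum fun l hl => ?_
    have hl0 : (l : ℝ) ≠ 0 := by
      have := (Finset.mem_Icc.1 hl).1
      exact_mod_cast (by omega : l ≠ 0)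
    convert! (((hasDerivAt_id θ).const_mul (l : ℝ)).sin).div_const (l : ℝ) using 1
    simp only [id]
    field_simp
  exact (((hasDerivAt_id θ).div_const 2).const_add (-Real.pi / 2)).add hsum

theorem tendsto_sum_cos_div_sq {θ : ℝ} (hθ : θ ∈ Set.Icc 0 (2 * Real.pi)) :
    Filter.Tendsto (fun M : ℕ => ∑ l ∈ Finset.Icc 1 M, Real.cos (l * θ) / (l : ℝ) ^ 2)
      Filter.atTop (nhds (Real.pi ^ 2 / 6 - Real.pi * θ / 2 + θ ^ 2 / 4)) := by
  have hπ := Real.pi_pos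
  have hx : θ / (2 * Real.pi) ∈ Set.Icc (0 : ℝ) 1 :=
    ⟨div_nonneg hθ.1 (by positivity), (div_le_one (by positivity)).2 hθ.2⟩
  have h := (hasSum_one_div_nat_pow_mul_cos one_ne_zero hx).tendsto_sum_nat
  have h2 := bernoulliFun_two (θ / (2 * Real.pi))
  rw [bernoulliFun] at h2
  rw [mul_one, h2] at h
  convert! h.comp (Filter.tendsto_add_atTop_nat 1) using 1
  · ext M
    simp only [Function.comp]
    rw [Finset.range_eq_Ico, Finset.sum_eq_sum_Ico_succ_bot (Nat.succ_pos M)]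
    have hI : Finset.Icc 1 M = Finset.Ico (0 + 1) (M + 1) := by
      ext l; simp only [Finset.mem_Icc, Finset.mem_Ico]; omega
    rw [hI]
    simp only [Nat.cast_zero, ne_eq, OfNat.ofNat_ne_zero, not_false_eq_true, zero_pow, div_zero,
      zero_mul, zero_add]
    refine Finset.sum_congr rfl fun l _ => ?_
    rw [div_mul_eq_mul_div, one_mul]
    congr 2
    field_simp
  · congr 1
    norm_num [Nat.factorial]
    field_simp
    ring

theorem abs_cosSeriesRemainder_le {m : ℕ} (hm : m ≠ 0) {θ : ℝ}
    (hθ : θ ∈ Set.Icc 0 (2 * Real.pi)) : |cosSeriesRemainder m θ| ≤ (m : ℝ)⁻¹ := by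
  have hlim := ((tendsto_sum_cos_div_sq hθ).sub_const
    (∑ l ∈ Finset.Icc 1 m, Real.cos (l * θ) / (l : ℝ) ^ 2)).abs
  refine le_of_tendsto hlim ?_
  filter_upwards [Filter.eventually_ge_atTop m] with M hM
  have hsplit : ∑ l ∈ Finset.Icc 1 M, Real.cos (l * θ) / (l : ℝ) ^ 2
      - ∑ l ∈ Finset.Icc 1 m, Real.cos (l * θ) / (l : ℝ) ^ 2
      = ∑ l ∈ Finset.Ioc m M, Real.cos (l * θ) / (l : ℝ) ^ 2 := by
    have hIcc : ∀ n : ℕ, Finset.Icc 1 n = Finset.Ioc 0 n := fun n => by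
      ext l; simp only [Finset.mem_Icc, Finset.mem_Ioc]; omega
    rw [hIcc, hIcc, sub_eq_iff_eq_add', Finset.sum_Ioc_consecutive _ (Nat.zero_le m) hM]
  rw [hsplit]
  calc |∑ l ∈ Finset.Ioc m M, Real.cos (l * θ) / (l : ℝ) ^ 2|
      ≤ ∑ l ∈ Finset.Ioc m M, |Real.cos (l * θ) / (l : ℝ) ^ 2| := Finset.abs_sum_le_sum_abs _ _
    _ ≤ ∑ l ∈ Finset.Ioc m M, ((l : ℝ) ^ 2)⁻¹ := by
        refine Finset.sum_le_sum fun l _ => ?_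
        rw [abs_div, abs_of_nonneg (sq_nonneg (l : ℝ)), inv_eq_one_div]
        gcongr
        exact Real.abs_cos_le_one _
    _ ≤ (m : ℝ)⁻¹ - (M : ℝ)⁻¹ := sum_Ioc_inv_sq_le_sub hm hM
    _ ≤ (m : ℝ)⁻¹ := sub_le_self _ (by positivity)

section Convolution

variable {E : Type*} [NormedAddCommGroup E] [NormedSpace ℝ E] [CompleteSpace E]

/-- Integrating by parts twice in the convolution of a kernel with a `C²` function. -/
theorem sub_integral_convolution_eq {t : ℝ} (ht : 0 ≤ t) {K K' K'' : ℝ → ℝ}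
    (hK : ∀ r, HasDerivAt K (K' r) r) (hK' : ∀ r, HasDerivAt K' (K'' r) r)
    (hK'' : Continuous K'') (hK'0 : K' 0 = -1) {u u' u'' : ℝ → E}
    (hu : ∀ s ∈ Set.Icc 0 t, HasDerivWithinAt u (u' s) (Set.Icc 0 t) s)
    (hu' : ∀ s ∈ Set.Icc 0 t, HasDerivWithinAt u' (u'' s) (Set.Icc 0 t) s)
    (hu'' : ContinuousOn u'' (Set.Icc 0 t)) (hu0 : u 0 = 0) :
    u t - ∫ s in (0 : ℝ)..t, K'' (t - s) • u s
      = K 0 • u' t - K t • u' 0 - ∫ s in (0 : ℝ)..t, K (t - s) • u'' s := by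
  have hKc : Continuous K := continuous_iff_continuousAt.2 fun r => (hK r).continuousAt
  have hK'c : Continuous K' := continuous_iff_continuousAt.2 fun r => (hK' r).continuousAt
  have hsub : Continuous fun s : ℝ => t - s := by fun_prop
  have huc : ContinuousOn u (Set.Icc 0 t) := fun s hs => (hu s hs).continuousWithinAt
  have hu'c : ContinuousOn u' (Set.Icc 0 t) := fun s hs => (hu' s hs).continuousWithinAt
  have hi₁ : IntervalIntegrable (fun s => K'' (t - s) • u s) volume 0 t :=
    ((hK''.comp hsub).continuousOn.smul huc).intervalIntegrable_of_Icc ht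
  have hi₂ : IntervalIntegrable (fun s => K (t - s) • u'' s) volume 0 t :=
    ((hKc.comp hsub).continuousOn.smul hu'').intervalIntegrable_of_Icc ht
  have hFTC := intervalIntegral.integral_eq_sub_of_hasDerivAt_of_le
    (f := fun s => -(K' (t - s) • u s) - K (t - s) • u' s)
    (f' := fun s => K'' (t - s) • u s - K (t - s) • u'' s) ht
    (((hK'c.comp hsub).continuousOn.smul huc).neg.sub ((hKc.comp hsub).continuousOn.smul hu'c))
    (fun s hs => by
      have hnhds := Icc_mem_nhds hs.1 hs.2
      have hmem := Set.Ioo_subset_Icc_self hs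
      have h₁ := (hu s hmem).hasDerivAt hnhds
      have h₂ := (hu' s hmem).hasDerivAt hnhds
      have hs' : HasDerivAt (fun s : ℝ => t - s) (-1) s := (hasDerivAt_id s).const_sub t
      have hA := (hK (t - s)).comp s hs'
      have hB := (hK' (t - s)).comp s hs'
      convert! ((hB.smul h₁).neg).sub (hA.smul h₂) using 1
      simp only [Function.comp]
      module)
    (hi₁.sub hi₂)
  rw [intervalIntegral.integral_sub hi₁ hi₂] at hFTC
  simp only [sub_self, sub_zero, hu0, hK'0, smul_zero, neg_zero, zero_sub] at hFTC
  rw [sub_eq_iff_eq_add] at hFTC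
  rw [hFTC]
  module

theorem norm_sub_integral_convolution_le {t C : ℝ} (ht : 0 ≤ t) {K K' K'' : ℝ → ℝ}
    (hK : ∀ r, HasDerivAt K (K' r) r) (hK' : ∀ r, HasDerivAt K' (K'' r) r)
    (hK'' : Continuous K'') (hK'0 : K' 0 = -1) (hC : ∀ r ∈ Set.Icc 0 t, |K r| ≤ C)
    {u u' u'' : ℝ → E}
    (hu : ∀ s ∈ Set.Icc 0 t, HasDerivWithinAt u (u' s) (Set.Icc 0 t) s)
    (hu' : ∀ s ∈ Set.Icc 0 t, HasDerivWithinAt u' (u'' s) (Set.Icc 0 t) s)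
    (hu'' : ContinuousOn u'' (Set.Icc 0 t)) (hu0 : u 0 = 0) :
    ‖u t - ∫ s in (0 : ℝ)..t, K'' (t - s) • u s‖
      ≤ C * (‖u' t‖ + ‖u' 0‖ + ∫ s in (0 : ℝ)..t, ‖u'' s‖) := by
  rw [sub_integral_convolution_eq ht hK hK' hK'' hK'0 hu hu' hu'' hu0]
  have h₁ : ‖K 0 • u' t‖ ≤ C * ‖u' t‖ := by
    rw [norm_smul]
    exact mul_le_mul_of_nonneg_right (hC 0 ⟨le_rfl, ht⟩) (norm_nonneg _)
  have h₂ : ‖K t • u' 0‖ ≤ C * ‖u' 0‖ := by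
    rw [norm_smul]
    exact mul_le_mul_of_nonneg_right (hC t ⟨ht, le_rfl⟩) (norm_nonneg _)
  have h₃ : ‖∫ s in (0 : ℝ)..t, K (t - s) • u'' s‖ ≤ C * ∫ s in (0 : ℝ)..t, ‖u'' s‖ := by
    rw [← intervalIntegral.integral_const_mul]
    refine intervalIntegral.norm_integral_le_of_norm_le ht
      (Filter.Eventually.of_forall fun s hs => ?_)
      ((hu''.norm.intervalIntegrable_of_Icc ht).const_mul C)
    rw [norm_smul]
    exact mul_le_mul_of_nonneg_right
      (hC (t - s) ⟨sub_nonneg.2 hs.2, sub_le_self t hs.1.le⟩) (norm_nonneg _)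
  calc _ ≤ ‖K 0 • u' t‖ + ‖K t • u' 0‖ + ‖∫ s in (0 : ℝ)..t, K (t - s) • u'' s‖ :=
        (norm_sub_le _ _).trans (add_le_add_left (norm_sub_le _ _) _)
    _ ≤ _ := by linarith

/-- Error of reproducing `u` by convolution with a truncated cosine series of the Dirac kernel. -/
theorem norm_sub_integral_cos_kernel_le {τ t : ℝ} (hτ : 0 < τ) (ht : t ∈ Set.Icc 0 τ)
    {m : ℕ} (hm : m ≠ 0) {u u' u'' : ℝ → E}
    (hu : ∀ s ∈ Set.Icc 0 t, HasDerivWithinAt u (u' s) (Set.Icc 0 t) s)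
    (hu' : ∀ s ∈ Set.Icc 0 t, HasDerivWithinAt u' (u'' s) (Set.Icc 0 t) s)
    (hu'' : ContinuousOn u'' (Set.Icc 0 t)) (hu0 : u 0 = 0) :
    ‖u t - ∫ s in (0 : ℝ)..t,
        (2 / τ * (1 / 2 + ∑ l ∈ Finset.Icc 1 m, Real.cos (l * (Real.pi / τ * (t - s))))) • u s‖
      ≤ 2 * τ / (Real.pi ^ 2 * m) * (‖u' t‖ + ‖u' 0‖ + ∫ s in (0 : ℝ)..t, ‖u'' s‖) := by
  have hπ := Real.pi_pos
  have hlin : ∀ r : ℝ, HasDerivAt (fun r => Real.pi / τ * r) (Real.pi / τ) r := fun r => by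
    simpa using (hasDerivAt_id r).const_mul (Real.pi / τ)
  refine norm_sub_integral_convolution_le
    (K := fun r => 2 * τ / Real.pi ^ 2 * cosSeriesRemainder m (Real.pi / τ * r))
    (K' := fun r => 2 / Real.pi * cosSeriesRemainderDeriv m (Real.pi / τ * r))
    (K'' := fun r => 2 / τ * (1 / 2 + ∑ l ∈ Finset.Icc 1 m, Real.cos (l * (Real.pi / τ * r))))
    ht.1 (fun r => ?_) (fun r => ?_) (by fun_prop) ?_ (fun r hr => ?_) hu hu' hu'' hu0
  · convert! ((hasDerivAt_cosSeriesRemainder m _).comp r (hlin r)).const_mul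
      (2 * τ / Real.pi ^ 2) using 1
    field_simp
  · convert! ((hasDerivAt_cosSeriesRemainderDeriv m _).comp r (hlin r)).const_mul
      (2 / Real.pi) using 1
    have hcoef : 2 / τ = 2 / Real.pi * (Real.pi / τ) := by field_simp
    rw [hcoef]
    ring
  · simp only [cosSeriesRemainderDeriv, mul_zero, Real.sin_zero, zero_div, Finset.sum_const_zero,
      add_zero]
    field_simp
  · have hθ : Real.pi / τ * r ∈ Set.Icc 0 (2 * Real.pi) := by
      refine ⟨mul_nonneg (by positivity) hr.1, ?_⟩
      rw [div_mul_eq_mul_div, div_le_iff₀ hτ]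
      nlinarith [hr.2, ht.2]
    rw [abs_mul, abs_of_pos (by positivity : (0 : ℝ) < 2 * τ / Real.pi ^ 2)]
    calc _ ≤ 2 * τ / Real.pi ^ 2 * (m : ℝ)⁻¹ :=
          mul_le_mul_of_nonneg_left (abs_cosSeriesRemainder_le hm hθ) (by positivity)
      _ = _ := by field_simp

end Convolution

theorem vnorm2_eq_norm {p : ℕ} (v : Fin p → ℝ) : vnorm2 v = ‖WithLp.toLp 2 v‖ := by
  simp [vnorm2, EuclideanSpace.norm_eq]

theorem vnorm2_le_vnorm1 {p : ℕ} (v : Fin p → ℝ) : vnorm2 v ≤ vnorm1 v := by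
  refine Real.sqrt_le_iff.2 ⟨Finset.sum_nonneg fun i _ => abs_nonneg _, ?_⟩
  simpa only [sq_abs, vnorm1] using
    Finset.sum_sq_le_sq_sum_of_nonneg (s := Finset.univ) fun i _ => abs_nonneg (v i)

theorem vnorm2_mulVec_le {p : ℕ} (M : Matrix (Fin p) (Fin p) ℝ) (v : Fin p → ℝ) :
    vnorm2 (M.mulVec v) ≤ sigmaMax M * vnorm2 v := by
  rw [vnorm2_eq_norm, vnorm2_eq_norm, ← Matrix.toEuclideanCLM_toLp]
  exact ContinuousLinearMap.le_opNorm _ _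

/-- **Error bound for the lossless approximation of a memoryless system (Theorem 1).**
For `u ∈ C²([0,τ],ℝᵖ)` with `u 0 = 0`, `y = k u` with `k = kₛ + kₐ`
(`kₛ` symmetric PSD, `kₐ` antisymmetric), and the truncated lossless kernel
`κ_N^c(r) = kₛ/(2τ) + Σ_{l=1}^{N-1} (kₛ/τ) cos(l ω₀ r)`, the output
`y_N = kₐ u + ∫₀ᵗ 2κ_N^c(t-s) u(s) ds` satisfies
`‖y(t) - y_N(t)‖₂ ≤ (2 σ̄(kₛ) τ/(π²(N-1))) (‖u̇(t)‖₂ + ‖u̇(0)‖₂ + ∫₀ᵗ ‖ü(s)‖₁ ds)`. -/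
theorem lossless_approx_memoryless_error_bound {p : ℕ}
    (τ : ℝ) (hτ : 0 < τ) (ω₀ : ℝ) (hω₀ : ω₀ = Real.pi / τ)
    (k ks ka : Matrix (Fin p) (Fin p) ℝ)
    (hk : k = ks + ka) (hks : ks.PosSemidef) (hka : kaᵀ = -ka)
    (N : ℕ) (hN : 2 ≤ N)
    (u u' u'' : ℝ → Fin p → ℝ)
    (hu : ∀ t ∈ Set.Icc (0:ℝ) τ, HasDerivWithinAt u (u' t) (Set.Icc 0 τ) t)
    (hu' : ∀ t ∈ Set.Icc (0:ℝ) τ, HasDerivWithinAt u' (u'' t) (Set.Icc 0 τ) t)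
    (hu'' : ContinuousOn u'' (Set.Icc 0 τ))
    (hu0 : u 0 = 0)
    (y yN : ℝ → Fin p → ℝ)
    (hy : ∀ t, y t = k.mulVec (u t))
    (κNc : ℝ → Matrix (Fin p) (Fin p) ℝ)
    (hκ : ∀ r : ℝ, κNc r =
      (1 / (2 * τ)) • ks + ∑ l ∈ Finset.Icc 1 (N - 1), ((1 / τ) * Real.cos (l * ω₀ * r)) • ks)
    (hyN : ∀ t, yN t = ka.mulVec (u t) + ∫ s in (0:ℝ)..t, ((2:ℝ) • κNc (t - s)).mulVec (u s)) :
    ∀ t ∈ Set.Icc (0:ℝ) τ,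
      vnorm2 (y t - yN t) ≤
        (2 * sigmaMax ks * τ / (Real.pi ^ 2 * ((N : ℝ) - 1))) *
          (vnorm2 (u' t) + vnorm2 (u' 0) + ∫ s in (0:ℝ)..t, vnorm1 (u'' s)) := by
  intro t ht
  subst hω₀
  have hm : N - 1 ≠ 0 := by omega
  have hcast : ((N - 1 : ℕ) : ℝ) = (N : ℝ) - 1 := by
    rw [Nat.cast_sub (by omega), Nat.cast_one]
  have hsub : Set.Icc 0 t ⊆ Set.Icc 0 τ := Set.Icc_subset_Icc_right ht.2
  have huc : ContinuousOn u (Set.Icc 0 t) := fun s hs =>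
    ((hu s (hsub hs)).mono hsub).continuousWithinAt
  have hu''c : ContinuousOn u'' (Set.Icc 0 t) := hu''.mono hsub
  set g : ℝ → ℝ := fun s => 2 / τ *
    (1 / 2 + ∑ l ∈ Finset.Icc 1 (N - 1), Real.cos (l * (Real.pi / τ * (t - s)))) with hg
  have hgc : Continuous g := by fun_prop
  have hgu : IntervalIntegrable (fun s => g s • u s) volume 0 t :=
    (hgc.continuousOn.smul huc).intervalIntegrable_of_Icc ht.1
  have hkernel : ∀ s, ((2 : ℝ) • κNc (t - s)).mulVec (u s) = ks.mulVec (g s • u s) := fun s => by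
    have hκs : (2 : ℝ) • κNc (t - s) = g s • ks := by
      rw [hκ, ← Finset.sum_smul, ← add_smul, smul_smul, ← Finset.mul_sum]
      congr 1
      simp only [hg, mul_assoc]
      ring
    rw [hκs, Matrix.smul_mulVec, Matrix.mulVec_smul]
  have hint : ∫ s in (0 : ℝ)..t, ((2 : ℝ) • κNc (t - s)).mulVec (u s)
      = ks.mulVec (∫ s in (0 : ℝ)..t, g s • u s) := by
    simp only [hkernel]
    exact (LinearMap.toContinuousLinearMap ks.mulVecLin).intervalIntegral_comp_comm hgu
  have herr : y t - yN t = ks.mulVec (u t - ∫ s in (0 : ℝ)..t, g s • u s) := by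
    rw [hy, hyN, hint, hk, Matrix.add_mulVec, Matrix.mulVec_sub]
    abel
  let L : (Fin p → ℝ) →L[ℝ] EuclideanSpace ℝ (Fin p) :=
    (PiLp.continuousLinearEquiv 2 ℝ fun _ : Fin p => ℝ).symm
  have hL : ∀ v, ‖L v‖ = vnorm2 v := fun v => (vnorm2_eq_norm v).symm
  have hbound := norm_sub_integral_cos_kernel_le hτ ht hm
    (u := fun s => L (u s)) (u' := fun s => L (u' s)) (u'' := fun s => L (u'' s))
    (fun s hs => L.hasFDerivAt.comp_hasDerivWithinAt s ((hu s (hsub hs)).mono hsub))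
    (fun s hs => L.hasFDerivAt.comp_hasDerivWithinAt s ((hu' s (hsub hs)).mono hsub))
    (L.continuous.comp_continuousOn hu''c) (by rw [hu0, map_zero])
  have hLint : L (∫ s in (0 : ℝ)..t, g s • u s) = ∫ s in (0 : ℝ)..t, g s • L (u s) := by
    rw [← L.intervalIntegral_comp_comm hgu]
    simp only [map_smul]
  rw [← hLint, ← map_sub, hcast] at hbound
  simp only [hL] at hbound
  have hc₂ : ContinuousOn (fun s => vnorm2 (u'' s)) (Set.Icc 0 t) := by
    simp only [← hL]
    exact (L.continuous.comp_continuousOn hu''c).norm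
  have hc₁ : ContinuousOn (fun s => vnorm1 (u'' s)) (Set.Icc 0 t) :=
    continuousOn_finsetSum _ fun i _ => ((continuousOn_pi.1 hu''c) i).abs
  have hmono : ∫ s in (0 : ℝ)..t, vnorm2 (u'' s) ≤ ∫ s in (0 : ℝ)..t, vnorm1 (u'' s) :=
    intervalIntegral.integral_mono_on ht.1 (hc₂.intervalIntegrable_of_Icc ht.1)
      (hc₁.intervalIntegrable_of_Icc ht.1) fun s _ => vnorm2_le_vnorm1 _
  have hN1 : (0 : ℝ) < (N : ℝ) - 1 := by
    rw [← hcast]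
    exact_mod_cast Nat.pos_of_ne_zero hm
  have hπ := Real.pi_pos
  have hσ : 0 ≤ sigmaMax ks := norm_nonneg _
  rw [herr]
  calc _ ≤ sigmaMax ks * vnorm2 (u t - ∫ s in (0 : ℝ)..t, g s • u s) := vnorm2_mulVec_le _ _
    _ ≤ sigmaMax ks * (2 * τ / (Real.pi ^ 2 * ((N : ℝ) - 1)) *
          (vnorm2 (u' t) + vnorm2 (u' 0) + ∫ s in (0 : ℝ)..t, vnorm1 (u'' s))) := by
        refine mul_le_mul_of_nonneg_left (hbound.trans ?_) hσ
        gcongr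
    _ = _ := by ring
end

section
/- Positive semidefinite shift of the Fourier coefficients (lemma in the proof of Theorem 2): let g : [0,∞) → ℝ^{p×p} with g ∈ L¹(0,∞), and suppose its Fourier transform ĝ(iω) = ∫₀^∞ g(t) e^{−iωt} dt satisfies ĝ(iω) + ĝ(iω)* ⪰ 0 (positive semidefinite) for all ω ∈ ℝ. Fix τ > 0 and let A_k, B_k be the matrix Fourier coefficients of g on [0,τ]. Then for every ξ ≥ (2/τ) ∫_τ^∞ ‖g(t)‖₁ dt and every integer k ≥ 0, the Hermitian matrix A_k − iB_k + ξ I_p is positive semidefinite. -/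
open Matrix MeasureTheory
open scoped ComplexOrder

/-- Entrywise `ℓ¹` norm of a real matrix. -/
noncomputable def mnorm1 {m n : ℕ} (M : Matrix (Fin m) (Fin n) ℝ) : ℝ :=
  ∑ i, ∑ j, |M i j|

/-- The matrix cosine Fourier coefficient `A_k = (1/τ)∫₀^τ (g+gᵀ) cos(kπt/τ) dt`. -/
noncomputable def Acoef {p : ℕ} (g : ℝ → Matrix (Fin p) (Fin p) ℝ) (τ : ℝ) (k : ℕ) :
    Matrix (Fin p) (Fin p) ℝ :=
  Matrix.of fun i j =>
    (1 / τ) * ∫ t in (0:ℝ)..τ, (g t i j + g t j i) * Real.cos (k * Real.pi * t / τ)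

/-- The matrix sine Fourier coefficient `B_k = (1/τ)∫₀^τ (g-gᵀ) sin(kπt/τ) dt`. -/
noncomputable def Bcoef {p : ℕ} (g : ℝ → Matrix (Fin p) (Fin p) ℝ) (τ : ℝ) (k : ℕ) :
    Matrix (Fin p) (Fin p) ℝ :=
  Matrix.of fun i j =>
    (1 / τ) * ∫ t in (0:ℝ)..τ, (g t i j - g t j i) * Real.sin (k * Real.pi * t / τ)

/-- The one-sided Fourier transform `ĝ(iω) = ∫₀^∞ g(t) e^{-iωt} dt`. -/
noncomputable def fourierG {p : ℕ} (g : ℝ → Matrix (Fin p) (Fin p) ℝ) (ω : ℝ) :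
    Matrix (Fin p) (Fin p) ℂ :=
  Matrix.of fun i j =>
    ∫ t in Set.Ioi (0:ℝ), (g t i j : ℂ) * Complex.exp (-(Complex.I * ω * t))

/-- If the entrywise `ℓ¹` norm of `T` is at most `c`, then `2c I - (T + Tᴴ)` is positive
semidefinite. -/
theorem Matrix.PosSemidef.smul_one_sub_add_conjTranspose {n : Type*} [Fintype n] [DecidableEq n]
    (T : Matrix n n ℂ) {c : ℝ} (hT : ∑ i, ∑ j, ‖T i j‖ ≤ c) :
    (((2 * c : ℝ) : ℂ) • (1 : Matrix n n ℂ) - (T + Tᴴ)).PosSemidef := by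
  refine .of_dotProduct_mulVec_nonneg ?_ fun x => ?_
  · ext i j
    by_cases h : i = j
    · subst h
      simp [add_comm]
    · simp [h, Ne.symm h, add_comm]
  · set w := star x ⬝ᵥ T *ᵥ x with hw
    set s := ∑ i, ‖x i‖ ^ 2 with hs
    have hself : star x ⬝ᵥ x = (s : ℂ) := by
      simp [dotProduct, hs, Complex.conj_mul']
    have hstar : star x ⬝ᵥ Tᴴ *ᵥ x = star w := by
      rw [hw, star_dotProduct, star_mulVec, conjTranspose_conjTranspose, ← dotProduct_mulVec]
    have hle : ∀ i, ‖x i‖ ^ 2 ≤ s := fun i =>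
      Finset.single_le_sum (f := fun i => ‖x i‖ ^ 2) (fun _ _ => sq_nonneg _) (Finset.mem_univ i)
    have hs0 : 0 ≤ s := Finset.sum_nonneg fun _ _ => sq_nonneg _
    have hwle : ‖w‖ ≤ c * s := by
      calc ‖w‖ ≤ ∑ i, ∑ j, ‖T i j‖ * s := by
            simp only [hw, dotProduct, mulVec, Finset.mul_sum]
            refine (norm_sum_le _ _).trans (Finset.sum_le_sum fun i _ => ?_)
            refine (norm_sum_le _ _).trans (Finset.sum_le_sum fun j _ => ?_)
            rw [norm_mul, norm_mul, Pi.star_apply, norm_star, mul_left_comm]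
            gcongr
            nlinarith [hle i, hle j, sq_nonneg (‖x i‖ - ‖x j‖)]
        _ = (∑ i, ∑ j, ‖T i j‖) * s := by simp only [Finset.sum_mul]
        _ ≤ c * s := by gcongr
    have hval : star x ⬝ᵥ (((2 * c : ℝ) : ℂ) • (1 : Matrix n n ℂ) - (T + Tᴴ)) *ᵥ x
        = ((2 * c * s - 2 * w.re : ℝ) : ℂ) := by
      rw [sub_mulVec, add_mulVec, smul_mulVec, one_mulVec, dotProduct_sub, dotProduct_add,
        dotProduct_smul, hstar, hself, ← hw, ← starRingEnd_apply, Complex.add_conj]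
      push_cast
      simp
    rw [hval, Complex.zero_le_real]
    linarith [Complex.re_le_norm w]

/-- The entrywise Fourier transform `∫ₛ g(t) e^{-iωt} dt` of `g` restricted to `s`. -/
noncomputable def fourierOn {p : ℕ} (g : ℝ → Matrix (Fin p) (Fin p) ℝ) (s : Set ℝ) (ω : ℝ) :
    Matrix (Fin p) (Fin p) ℂ :=
  Matrix.of fun i j => ∫ t in s, (g t i j : ℂ) * Complex.exp (-(Complex.I * ω * t))

theorem norm_exp_neg_I_mul_mul (ω t : ℝ) : ‖Complex.exp (-(Complex.I * ω * t))‖ = 1 := by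
  simp [Complex.norm_exp]

theorem MeasureTheory.IntegrableOn.ofReal_mul_exp {f : ℝ → ℝ} {s : Set ℝ} (hf : IntegrableOn f s)
    (ω : ℝ) : IntegrableOn (fun t => (f t : ℂ) * Complex.exp (-(Complex.I * ω * t))) s := by
  refine Integrable.mul_bdd (c := 1) hf.ofReal ?_ ?_
  · exact (by fun_prop : Continuous fun t : ℝ => Complex.exp (-(Complex.I * ω * t)))
      |>.aestronglyMeasurable
  · exact .of_forall fun t => (norm_exp_neg_I_mul_mul ω t).le

theorem fourierG_eq_fourierOn_add {p : ℕ} {g : ℝ → Matrix (Fin p) (Fin p) ℝ}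
    (hg : ∀ i j, IntegrableOn (fun t => g t i j) (Set.Ioi 0)) {τ : ℝ} (hτ : 0 ≤ τ) (ω : ℝ) :
    fourierG g ω = fourierOn g (Set.Ioc 0 τ) ω + fourierOn g (Set.Ioi τ) ω := by
  ext i j
  have hint := (hg i j).ofReal_mul_exp ω
  rw [← Set.Ioc_union_Ioi_eq_Ioi hτ] at hint
  simp only [fourierG, fourierOn, Matrix.of_apply, Matrix.add_apply]
  rw [← Set.Ioc_union_Ioi_eq_Ioi hτ, setIntegral_union (Set.Ioc_disjoint_Ioi le_rfl)
    measurableSet_Ioi hint.left_of_union hint.right_of_union]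

theorem sum_norm_fourierOn_le {p : ℕ} {g : ℝ → Matrix (Fin p) (Fin p) ℝ} {s : Set ℝ}
    (hg : ∀ i j, IntegrableOn (fun t => g t i j) s) (ω : ℝ) :
    ∑ i, ∑ j, ‖fourierOn g s ω i j‖ ≤ ∫ t in s, mnorm1 (g t) := by
  simp only [mnorm1]
  rw [integral_finsetSum _ fun i _ => integrable_finsetSum _ fun j _ => (hg i j).abs]
  refine Finset.sum_le_sum fun i _ => ?_
  rw [integral_finsetSum _ fun j _ => (hg i j).abs]
  refine Finset.sum_le_sum fun j _ => (norm_integral_le_integral_norm _).trans_eq ?_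
  simp [norm_exp_neg_I_mul_mul]

theorem Acoef_sub_I_smul_Bcoef {p : ℕ} {g : ℝ → Matrix (Fin p) (Fin p) ℝ} {τ : ℝ} (hτ : 0 ≤ τ)
    (hg : ∀ i j, IntegrableOn (fun t => g t i j) (Set.Ioc 0 τ)) (k : ℕ) :
    (Acoef g τ k).map Complex.ofReal - Complex.I • (Bcoef g τ k).map Complex.ofReal =
      ((1 / τ : ℝ) : ℂ) • (fourierOn g (Set.Ioc 0 τ) (k * Real.pi / τ) +
        (fourierOn g (Set.Ioc 0 τ) (k * Real.pi / τ))ᴴ) := by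
  ext i j
  set ω : ℝ := k * Real.pi / τ with hω
  have harg : ∀ t : ℝ, k * Real.pi * t / τ = ω * t := fun t => by rw [hω]; ring
  have hcos : IntegrableOn (fun t => (g t i j + g t j i) * Real.cos (ω * t)) (Set.Ioc 0 τ) :=
    ((hg i j).add (hg j i)).mul_bdd (c := 1)
      (by fun_prop : Continuous fun t : ℝ => Real.cos (ω * t)).aestronglyMeasurable
      (.of_forall fun t => Real.abs_cos_le_one _)
  have hsin : IntegrableOn (fun t => (g t i j - g t j i) * Real.sin (ω * t)) (Set.Ioc 0 τ) :=
    ((hg i j).sub (hg j i)).mul_bdd (c := 1)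
      (by fun_prop : Continuous fun t : ℝ => Real.sin (ω * t)).aestronglyMeasurable
      (.of_forall fun t => Real.abs_sin_le_one _)
  have hconj : IntegrableOn (fun t => starRingEnd ℂ
      ((g t j i : ℂ) * Complex.exp (-(Complex.I * ω * t)))) (Set.Ioc 0 τ) :=
    (Complex.conjLIE.toContinuousLinearEquiv.toContinuousLinearMap).integrable_comp
      ((hg j i).ofReal_mul_exp ω)
  have key : ((∫ t in Set.Ioc 0 τ, (g t i j + g t j i) * Real.cos (ω * t) : ℝ) : ℂ) -
      Complex.I * ((∫ t in Set.Ioc 0 τ, (g t i j - g t j i) * Real.sin (ω * t) : ℝ) : ℂ) =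
      fourierOn g (Set.Ioc 0 τ) ω i j + starRingEnd ℂ (fourierOn g (Set.Ioc 0 τ) ω j i) := by
    simp only [fourierOn, Matrix.of_apply]
    rw [← integral_conj, ← integral_complex_ofReal, ← integral_complex_ofReal,
      ← integral_const_mul, ← integral_sub hcos.ofReal (hsin.ofReal.const_mul _),
      ← integral_add ((hg i j).ofReal_mul_exp ω) hconj]
    refine integral_congr_ae (.of_forall fun t => ?_)
    have h1 : Complex.exp (-(Complex.I * ω * t)) =
        Complex.cos (ω * t) - Complex.sin (ω * t) * Complex.I := by
      rw [show -(Complex.I * ω * t) = -(ω * t : ℂ) * Complex.I by ring, Complex.exp_mul_I,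
        Complex.cos_neg, Complex.sin_neg]
      ring
    have h2 : starRingEnd ℂ (Complex.exp (-(Complex.I * ω * t))) =
        Complex.cos (ω * t) + Complex.sin (ω * t) * Complex.I := by
      rw [← Complex.exp_conj, ← Complex.exp_mul_I]
      simp only [map_neg, map_mul, Complex.conj_I, Complex.conj_ofReal]
      ring_nf
    simp only [map_mul, Complex.conj_ofReal, h2]
    rw [h1]
    push_cast
    ring
  simp only [Matrix.sub_apply, Matrix.smul_apply, Matrix.map_apply, Matrix.add_apply,
    conjTranspose_apply, Acoef, Bcoef, Matrix.of_apply, harg,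
    intervalIntegral.integral_of_le hτ, smul_eq_mul]
  rw [← starRingEnd_apply, ← key]
  push_cast
  ring

/-- **Positive semidefinite shift of the Fourier coefficients (lemma in the proof
of Theorem 2).**  If `g ∈ L¹(0,∞)` and `ĝ(iω) + ĝ(iω)* ⪰ 0` for all real `ω`,
then for every `ξ ≥ (2/τ)∫_τ^∞ ‖g(t)‖₁ dt` and every `k ≥ 0` the Hermitian matrix
`A_k - iB_k + ξ I` is positive semidefinite. -/
theorem fourier_coefficient_psd_shift {p : ℕ}
    (g : ℝ → Matrix (Fin p) (Fin p) ℝ)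
    (hL1 : ∀ i j : Fin p, IntegrableOn (fun t => g t i j) (Set.Ioi 0))
    (hPR : ∀ ω : ℝ, (fourierG g ω + (fourierG g ω).conjTranspose).PosSemidef)
    (τ : ℝ) (hτ : 0 < τ) :
    ∀ ξ : ℝ, (2 / τ) * (∫ t in Set.Ioi τ, mnorm1 (g t)) ≤ ξ →
      ∀ k : ℕ,
        ((Acoef g τ k).map (Complex.ofReal) -
            Complex.I • (Bcoef g τ k).map (Complex.ofReal) +
            (ξ : ℂ) • (1 : Matrix (Fin p) (Fin p) ℂ)).PosSemidef := by
  intro ξ hξ k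
  set ω : ℝ := k * Real.pi / τ with hω
  have hIoi : ∀ i j, IntegrableOn (fun t => g t i j) (Set.Ioi τ) := fun i j =>
    (hL1 i j).mono_set (Set.Ioi_subset_Ioi hτ.le)
  have hIoc : ∀ i j, IntegrableOn (fun t => g t i j) (Set.Ioc 0 τ) := fun i j =>
    (hL1 i j).mono_set Set.Ioc_subset_Ioi_self
  have htail : ∑ i, ∑ j, ‖fourierOn g (Set.Ioi τ) ω i j‖ ≤ τ * ξ / 2 := by
    refine (sum_norm_fourierOn_le hIoi ω).trans ?_
    rw [div_mul_eq_mul_div, div_le_iff₀ hτ] at hξ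
    linarith
  have hsum := ((hPR ω).add (.smul_one_sub_add_conjTranspose _ htail)).smul
    (Complex.zero_le_real.2 (one_div_pos.2 hτ).le)
  rw [Acoef_sub_I_smul_Bcoef hτ.le hIoc k, ← hω]
  convert hsum using 1
  have hξτ : (ξ : ℂ) = ((1 / τ : ℝ) : ℂ) * ((2 * (τ * ξ / 2) : ℝ) : ℂ) := by
    rw [← Complex.ofReal_mul]
    congr 1
    field_simp
  rw [hξτ, mul_smul, ← smul_add, fourierG_eq_fourierOn_add hL1 hτ.le, conjTranspose_add]
  congr 1
  abel
end

section
/- Error bound for the nonlinear lossless approximation of an active memoryless system (Theorem 4): let k ∈ ℝ^{p×p}, E₀ > 0, τ > 0, and let u : [0,τ] → ℝᵖ be continuous with ‖u(t)‖₂ ≤ ū for all t ∈ [0,τ]. Define y(t) = k u(t) and y_E(t) = k u(t) + (1/(2E₀)) k u(t) ∫₀ᵗ u(s)ᵀ k u(s) ds. Then for every t ∈ [0,τ]: ‖y_E(t) − y(t)‖₂ ≤ ε ‖u‖_{L²[0,t]}, where ε = σ̄(k)² ū² √τ / (2E₀). -/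
open Matrix MeasureTheory

/-- The `L²[0,t]` norm of a vector-valued signal. -/
noncomputable def L2norm {p : ℕ} (u : ℝ → Fin p → ℝ) (t : ℝ) : ℝ :=
  Real.sqrt (∫ s in (0:ℝ)..t, vnorm2 (u s) ^ 2)

theorem vnorm2_nonneg {p : ℕ} (v : Fin p → ℝ) : 0 ≤ vnorm2 v := Real.sqrt_nonneg _

theorem vnorm2_smul {p : ℕ} (c : ℝ) (v : Fin p → ℝ) : vnorm2 (c • v) = |c| * vnorm2 v := by
  rw [vnorm2_eq_norm, vnorm2_eq_norm, WithLp.toLp_smul, norm_smul, Real.norm_eq_abs]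

theorem continuous_vnorm2 {p : ℕ} : Continuous (vnorm2 : (Fin p → ℝ) → ℝ) := by
  unfold vnorm2
  fun_prop

theorem sigmaMax_nonneg {p : ℕ} (M : Matrix (Fin p) (Fin p) ℝ) : 0 ≤ sigmaMax M :=
  norm_nonneg _

theorem abs_dotProduct_le_vnorm2_mul {p : ℕ} (v w : Fin p → ℝ) :
    |v ⬝ᵥ w| ≤ vnorm2 v * vnorm2 w := by
  rw [vnorm2_eq_norm, vnorm2_eq_norm, mul_comm]
  simpa [EuclideanSpace.inner_eq_star_dotProduct] using
    abs_real_inner_le_norm (WithLp.toLp 2 w) (WithLp.toLp 2 v)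

theorem abs_dotProduct_mulVec_le {p : ℕ} (M : Matrix (Fin p) (Fin p) ℝ) (v : Fin p → ℝ) :
    |v ⬝ᵥ M.mulVec v| ≤ sigmaMax M * vnorm2 v ^ 2 :=
  calc |v ⬝ᵥ M.mulVec v| ≤ vnorm2 v * vnorm2 (M.mulVec v) := abs_dotProduct_le_vnorm2_mul _ _
    _ ≤ vnorm2 v * (sigmaMax M * vnorm2 v) :=
      mul_le_mul_of_nonneg_left (vnorm2_mulVec_le M v) (vnorm2_nonneg v)
    _ = sigmaMax M * vnorm2 v ^ 2 := by ring

theorem L2norm_sq {p : ℕ} (u : ℝ → Fin p → ℝ) {t : ℝ} (ht : 0 ≤ t) :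
    L2norm u t ^ 2 = ∫ s in (0 : ℝ)..t, vnorm2 (u s) ^ 2 :=
  Real.sq_sqrt (intervalIntegral.integral_nonneg ht fun _ _ => sq_nonneg _)

theorem abs_integral_dotProduct_mulVec_le {p : ℕ} (M : Matrix (Fin p) (Fin p) ℝ)
    {u : ℝ → Fin p → ℝ} (hu : Continuous u) {t : ℝ} (ht : 0 ≤ t) :
    |∫ s in (0 : ℝ)..t, u s ⬝ᵥ M.mulVec (u s)| ≤ sigmaMax M * L2norm u t ^ 2 := by
  rw [L2norm_sq u ht, ← intervalIntegral.integral_const_mul, ← Real.norm_eq_abs]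
  have hc := continuous_vnorm2.comp hu
  refine intervalIntegral.norm_integral_le_of_norm_le ht
    (Filter.Eventually.of_forall fun s _ => abs_dotProduct_mulVec_le M (u s)) ?_
  exact ((hc.pow 2).const_mul _).intervalIntegrable _ _

theorem L2norm_le_mul_sqrt {p : ℕ} {u : ℝ → Fin p → ℝ} (hu : Continuous u) {t b : ℝ}
    (ht : 0 ≤ t) (hb : ∀ s ∈ Set.Icc 0 t, vnorm2 (u s) ≤ b) :
    L2norm u t ≤ b * Real.sqrt t := by
  have hb0 : 0 ≤ b := (vnorm2_nonneg _).trans (hb 0 ⟨le_rfl, ht⟩)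
  refine Real.sqrt_le_iff.2 ⟨by positivity, ?_⟩
  have hc := continuous_vnorm2.comp hu
  calc (∫ s in (0 : ℝ)..t, vnorm2 (u s) ^ 2) ≤ ∫ _ in (0 : ℝ)..t, b ^ 2 :=
        intervalIntegral.integral_mono_on ht ((hc.pow 2).intervalIntegrable _ _)
          intervalIntegrable_const
          fun s hs => pow_le_pow_left₀ (vnorm2_nonneg _) (hb s hs) 2
    _ = (b * Real.sqrt t) ^ 2 := by
        rw [intervalIntegral.integral_const, mul_pow, Real.sq_sqrt ht, smul_eq_mul]
        ring

/-- **Error bound for the nonlinear lossless approximation of an active memoryless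
system (Theorem 4).**  For `y = k u` and the output
`y_E(t) = k u(t) + (1/(2E₀)) k u(t) ∫₀ᵗ u(s)ᵀ k u(s) ds` of the nonlinear lossless
approximation charged with initial energy `E₀`, if `‖u(t)‖₂ ≤ ū` on `[0,τ]` then
`‖y_E(t) - y(t)‖₂ ≤ ε ‖u‖_{L²[0,t]}` with `ε = σ̄(k)² ū² √τ/(2E₀)`. -/
theorem nonlinear_lossless_approx_error_bound {p : ℕ}
    (k : Matrix (Fin p) (Fin p) ℝ) (E₀ : ℝ) (hE₀ : 0 < E₀)
    (τ : ℝ) (hτ : 0 < τ) (ubar : ℝ)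
    (u : ℝ → Fin p → ℝ) (hu : Continuous u)
    (hubar : ∀ t ∈ Set.Icc (0:ℝ) τ, vnorm2 (u t) ≤ ubar)
    (y yE : ℝ → Fin p → ℝ)
    (hy : ∀ t, y t = k.mulVec (u t))
    (hyE : ∀ t, yE t = k.mulVec (u t) +
      (1 / (2 * E₀)) • (∫ s in (0:ℝ)..t, u s ⬝ᵥ k.mulVec (u s)) • k.mulVec (u t)) :
    ∀ t ∈ Set.Icc (0:ℝ) τ,
      vnorm2 (yE t - y t) ≤
        (sigmaMax k ^ 2 * ubar ^ 2 * Real.sqrt τ / (2 * E₀)) * L2norm u t := by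
  intro t ht
  have hσ := sigmaMax_nonneg k
  have hL : 0 ≤ L2norm u t := Real.sqrt_nonneg _
  have hb : 0 ≤ ubar := (vnorm2_nonneg _).trans (hubar t ht)
  have hLb : L2norm u t ≤ ubar * Real.sqrt τ :=
    (L2norm_le_mul_sqrt hu ht.1 fun s hs => hubar s ⟨hs.1, hs.2.trans ht.2⟩).trans
      (mul_le_mul_of_nonneg_left (Real.sqrt_le_sqrt ht.2) hb)
  have hint : |∫ s in (0 : ℝ)..t, u s ⬝ᵥ k.mulVec (u s)| ≤
      sigmaMax k * (ubar * Real.sqrt τ * L2norm u t) := by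
    refine (abs_integral_dotProduct_mulVec_le k hu ht.1).trans
      (mul_le_mul_of_nonneg_left ?_ hσ)
    rw [sq]
    exact mul_le_mul_of_nonneg_right hLb hL
  have hku : vnorm2 (k.mulVec (u t)) ≤ sigmaMax k * ubar :=
    (vnorm2_mulVec_le k _).trans (mul_le_mul_of_nonneg_left (hubar t ht) hσ)
  rw [hyE, hy, add_sub_cancel_left, vnorm2_smul, vnorm2_smul,
    abs_of_pos (by positivity : 0 < 1 / (2 * E₀))]
  calc 1 / (2 * E₀) * (|∫ s in (0 : ℝ)..t, u s ⬝ᵥ k.mulVec (u s)| * vnorm2 (k.mulVec (u t)))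
      ≤ 1 / (2 * E₀) * (sigmaMax k * (ubar * Real.sqrt τ * L2norm u t) * (sigmaMax k * ubar)) :=
        mul_le_mul_of_nonneg_left
          (mul_le_mul hint hku (vnorm2_nonneg _) (by positivity)) (by positivity)
    _ = sigmaMax k ^ 2 * ubar ^ 2 * Real.sqrt τ / (2 * E₀) * L2norm u t := by ring
end

section
/- Losslessness of the nonlinear lossless approximation of a general ODE system: let f : ℝⁿ × ℝᵖ → ℝⁿ and g : ℝⁿ × ℝᵖ → ℝᵖ be continuous, E₀ > 0, and let u : [0,τ] → ℝᵖ be continuous. Along every solution (x̂, x_E) of the system ẋ̂(t) = (x_E(t)/√(2E₀)) f(x̂(t),u(t)), ẋ_E(t) = (1/√(2E₀)) ( g(x̂(t),u(t))ᵀ u(t) − x̂(t)ᵀ f(x̂(t),u(t)) ), with output y_E(t) = (x_E(t)/√(2E₀)) g(x̂(t),u(t)), the total energy E(t) = (1/2) x̂(t)ᵀ x̂(t) + (1/2) x_E(t)² satisfies dE/dt = y_E(t)ᵀ u(t) for all t. -/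
open Matrix

/-- Product rule for the squared Euclidean length `x ⬝ᵥ x` of a curve. -/
theorem HasDerivWithinAt.dotProduct_self {ι : Type*} [Fintype ι] {x : ℝ → ι → ℝ} {x' : ι → ℝ}
    {s : Set ℝ} {t : ℝ} (h : HasDerivWithinAt x x' s t) :
    HasDerivWithinAt (fun r => x r ⬝ᵥ x r) (2 * (x t ⬝ᵥ x')) s t := by
  have hi := hasDerivWithinAt_pi.1 h
  have hs := HasDerivWithinAt.fun_sum (u := Finset.univ) fun i _ => (hi i).fun_mul (hi i)
  refine hs.congr_deriv ?_
  simp only [dotProduct, Finset.mul_sum]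
  exact Finset.sum_congr rfl fun i _ => by ring

/-- **Losslessness of the nonlinear lossless approximation of a general ODE
system.**  Along every solution `(x̂, x_E)` of
`ẋ̂ = (x_E/√(2E₀)) f(x̂,u)`,
`ẋ_E = (1/√(2E₀)) (g(x̂,u)ᵀu - x̂ᵀf(x̂,u))`,
with output `y_E = (x_E/√(2E₀)) g(x̂,u)`, the total energy
`E = (1/2)x̂ᵀx̂ + (1/2)x_E²` satisfies `dE/dt = y_Eᵀu`. -/
theorem nonlinear_lossless_approx_is_lossless {n p : ℕ}
    (f : (Fin n → ℝ) → (Fin p → ℝ) → Fin n → ℝ)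
    (g : (Fin n → ℝ) → (Fin p → ℝ) → Fin p → ℝ)
    (hf : Continuous fun q : (Fin n → ℝ) × (Fin p → ℝ) => f q.1 q.2)
    (hg : Continuous fun q : (Fin n → ℝ) × (Fin p → ℝ) => g q.1 q.2)
    (E₀ : ℝ) (hE₀ : 0 < E₀) (τ : ℝ) (hτ : 0 < τ)
    (u : ℝ → Fin p → ℝ) (hu : Continuous u)
    (xhat : ℝ → Fin n → ℝ) (xE : ℝ → ℝ)
    (hxhat : ∀ t ∈ Set.Icc (0:ℝ) τ,
      HasDerivWithinAt xhat
        ((xE t / Real.sqrt (2 * E₀)) • f (xhat t) (u t)) (Set.Icc 0 τ) t)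
    (hxE : ∀ t ∈ Set.Icc (0:ℝ) τ,
      HasDerivWithinAt xE
        ((1 / Real.sqrt (2 * E₀)) *
          (g (xhat t) (u t) ⬝ᵥ u t - xhat t ⬝ᵥ f (xhat t) (u t))) (Set.Icc 0 τ) t)
    (yE : ℝ → Fin p → ℝ)
    (hyE : ∀ t, yE t = (xE t / Real.sqrt (2 * E₀)) • g (xhat t) (u t)) :
    ∀ t ∈ Set.Icc (0:ℝ) τ,
      HasDerivWithinAt
        (fun r => (1 / 2) * (xhat r ⬝ᵥ xhat r) + (1 / 2) * xE r ^ 2)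
        (yE t ⬝ᵥ u t) (Set.Icc 0 τ) t := by
  intro t ht
  have h := ((hxhat t ht).dotProduct_self.const_mul (1 / 2)).fun_add
    (((hxE t ht).fun_pow 2).const_mul (1 / 2))
  refine h.congr_deriv ?_
  rw [hyE, dotProduct_smul, smul_dotProduct]
  simp only [smul_eq_mul]
  ring
end
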